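/- The right ℤ[F]-module C(D, ℤ) of continuous functions D → ℤ (which is isomorphic to the zeroth Čech cohomology of D with integer coefficients) is finitely presented. -/

import Mathlib

open scoped BigOperators

namespace DecompPaper

variable (B : Type) [DecidableEq B]

/-- The set of letters `B ⊔ B⁻¹` carries the discrete topology. -/
instance : TopologicalSpace (B × Bool) := ⊥

/-- The Gromov boundary `∂F` of the free group on `B`: the space of infinite reduced
words, i.e. sequences of letters with no cancelling adjacent pair, topologized as a
subspace of the product of discrete spaces. -/
abbrev Boundary : Type :=
  {s : ℕ → B × Bool // ∀ k, s (k + 1) ≠ ((s k).1, !(s k).2)}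

/-- The prefix of length `m` of an infinite reduced word, as an element of the free group. -/
def prefixOf (ξ : Boundary B) (m : ℕ) : FreeGroup B :=
  FreeGroup.mk (List.ofFn fun i : Fin m => ξ.1 i)

/-- Adjacency in the Cayley graph `T` of the free group with respect to `B`. -/
def Adj (g h : FreeGroup B) : Prop :=
  ∃ x : B × Bool, h = g * FreeGroup.mk [x]

/-- A set of vertices of `T` is a subtree iff any two of its vertices are joined by a
path in the Cayley graph staying inside the set. -/
def IsSubtree (X : Set (FreeGroup B)) : Prop :=
  ∀ g ∈ X, ∀ h ∈ X, Relation.ReflTransGen (fun a b => Adj B a b ∧ b ∈ X) g h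

/-- `C` is a connected component of `T ∖ X`. -/
def IsComponentOf (X C : Set (FreeGroup B)) : Prop :=
  ∃ v, v ∉ X ∧
    C = {u | Relation.ReflTransGen (fun a b => Adj B a b ∧ a ∉ X ∧ b ∉ X) v u}

/-- `∂C`: the set of boundary points all of whose sufficiently long prefixes lie in `C`. -/
def boundaryOf (C : Set (FreeGroup B)) : Set (Boundary B) :=
  {ξ | ∃ m, ∀ k, m ≤ k → prefixOf B ξ k ∈ C}

/-- The sequence `a` of group elements converges to the boundary point `ξ`:
every prefix of `ξ` is eventually an initial segment of the reduced word of `a k`. -/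
def TendstoBoundary (a : ℕ → FreeGroup B) (ξ : Boundary B) : Prop :=
  ∀ m : ℕ, ∃ K, ∀ k, K ≤ k → (List.ofFn fun i : Fin m => ξ.1 i) <+: (a k).toWord

/-- `{ξ, η}` is a line of the line pattern generated by the words `w i`: for some
`g` and `i`, `ξ` and `η` are the limits of `g * (w i) ^ k` as `k → +∞` and `k → -∞`
(in one of the two orders). -/
def IsLine {r : ℕ} (w : Fin r → FreeGroup B) (ξ η : Boundary B) : Prop :=
  ∃ (g : FreeGroup B) (i : Fin r),
    (TendstoBoundary B (fun k => g * w i ^ k) ξ ∧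
       TendstoBoundary B (fun k => g * (w i)⁻¹ ^ k) η) ∨
    (TendstoBoundary B (fun k => g * w i ^ k) η ∧
       TendstoBoundary B (fun k => g * (w i)⁻¹ ^ k) ξ)

/-- Malnormality of the family of cyclic subgroups `⟨w i⟩`. -/
def Malnormal {r : ℕ} (w : Fin r → FreeGroup B) : Prop :=
  ∀ (g : FreeGroup B) (i j : Fin r),
    (∃ x : FreeGroup B, x ∈ Subgroup.zpowers (w i) ∧ x ≠ 1 ∧
        g * x * g⁻¹ ∈ Subgroup.zpowers (w j)) →
      i = j ∧ g ∈ Subgroup.zpowers (w i)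

/-- The decomposition space `D`: the quotient of `∂F` by the smallest equivalence
relation identifying the two endpoints of each line, with the quotient topology. -/
abbrev DSpace {r : ℕ} (w : Fin r → FreeGroup B) : Type :=
  Quot (IsLine B w)

/-- The quotient projection `q : ∂F → D`. -/
def qmap {r : ℕ} (w : Fin r → FreeGroup B) : Boundary B → DSpace B w :=
  Quot.mk _

/-- The geodesic of the line with endpoints `ξ` and `η`: all prefixes of `ξ` or of `η`
of length at least the length of their longest common initial segment. -/
def lineGeodesic (ξ η : Boundary B) : Set (FreeGroup B) :=
  {g | ∃ k : ℕ, (g = prefixOf B ξ k ∨ g = prefixOf B η k) ∧ ∃ i ≤ k, ξ.1 i ≠ η.1 i}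

/-- The line with endpoints `ξ, η` passes through the subtree `X`. -/
def PassesThrough (ξ η : Boundary B) (X : Set (FreeGroup B)) : Prop :=
  ∃ g ∈ X, g ∈ lineGeodesic B ξ η

/-- A function `σ : D → ℤ` is supported on the subtree `X` if `σ ∘ q` is constant on
`∂C` for every connected component `C` of `T ∖ X`. -/
def SupportedOn {r : ℕ} (w : Fin r → FreeGroup B) (σ : DSpace B w → ℤ)
    (X : Set (FreeGroup B)) : Prop :=
  ∀ C : Set (FreeGroup B), IsComponentOf B X C →
    ∀ ξ, ξ ∈ boundaryOf B C → ∀ η, η ∈ boundaryOf B C →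
      σ (qmap B w ξ) = σ (qmap B w η)

/-- Prepending a letter to an infinite reduced word, cancelling if necessary. -/
def consB (x : B × Bool) (ξ : Boundary B) : Boundary B :=
  if h : ξ.1 0 = (x.1, !x.2) then
    ⟨fun k => ξ.1 (k + 1), fun k => ξ.2 (k + 1)⟩
  else
    ⟨fun k => Nat.rec x (fun j _ => ξ.1 j) k, by
      intro k
      cases k with
      | zero => exact h
      | succ j => exact ξ.2 j⟩

/-- The action of the free group on its boundary: left multiplication followed by
reduction. -/
def actB (g : FreeGroup B) (ξ : Boundary B) : Boundary B :=
  g.toWord.foldr (consB B) ξ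

/-- The induced action of the free group on the decomposition space. -/
noncomputable def actD {r : ℕ} (w : Fin r → FreeGroup B) (g : FreeGroup B)
    (x : DSpace B w) : DSpace B w :=
  qmap B w (actB B g (Quot.out x))

/-- The map `p : (ℤ[F])^k → C(D, ℤ)` of right `ℤ[F]`-modules determined by generators
`σ j`, where an element of the free module `(ℤ[F])^k` is recorded as a finitely
supported function `(Fin k × F) →₀ ℤ` and `e_j · g` is sent to `σ j · g`. -/
noncomputable def pMap {r : ℕ} (w : Fin r → FreeGroup B) {k : ℕ}
    (σ : Fin k → DSpace B w → ℤ) (x : (Fin k × FreeGroup B) →₀ ℤ) :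
    DSpace B w → ℤ :=
  fun d => x.sum fun p n => n * σ p.1 (actD B w p.2 d)

/-- Right translation by `g` on the free module `(ℤ[F])^k`, sending `e_j · h` to
`e_j · (h * g)`. -/
noncomputable def fsTranslate {k : ℕ} (y : (Fin k × FreeGroup B) →₀ ℤ)
    (g : FreeGroup B) : (Fin k × FreeGroup B) →₀ ℤ :=
  Finsupp.mapDomain (fun p => (p.1, p.2 * g)) y

/-- The convex hull of a set of vertices of `T`: the smallest subtree containing it. -/
def hull (S : Set (FreeGroup B)) : Set (FreeGroup B) :=
  ⋂₀ {Y : Set (FreeGroup B) | IsSubtree B Y ∧ S ⊆ Y}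

/-- The support of an element of the free module `(ℤ[F])^k`, relative to supports
`X j` of the generators: the convex hull of the union of the sets `g⁻¹ • X j` over
the pairs `(j, g)` appearing with nonzero coefficient. -/
def fsSupport {k : ℕ} (X : Fin k → Set (FreeGroup B))
    (x : (Fin k × FreeGroup B) →₀ ℤ) : Set (FreeGroup B) :=
  hull B (⋃ p ∈ x.support, (fun v => p.2⁻¹ * v) '' X p.1)

/-- Antisymmetry of a `1`-cochain on oriented lines. -/
def Antisym {r : ℕ} (w : Fin r → FreeGroup B)
    (f : Boundary B → Boundary B → ℤ) : Prop :=
  ∀ ξ η, IsLine B w ξ η → f η ξ = -f ξ η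

/-- A `1`-cochain is supported on the subtree `X`: it vanishes on lines not passing
through `X`, and depends only on the pair of components of `T ∖ X` containing the two
endpoints. -/
def SupportedOn1 {r : ℕ} (w : Fin r → FreeGroup B)
    (f : Boundary B → Boundary B → ℤ) (X : Set (FreeGroup B)) : Prop :=
  (∀ ξ η, IsLine B w ξ η → ¬PassesThrough B ξ η X → f ξ η = 0) ∧
  (∀ C C' : Set (FreeGroup B), IsComponentOf B X C → IsComponentOf B X C' → C ≠ C' →
    ∀ ξ ξ' η η', IsLine B w ξ η → IsLine B w ξ' η' →
      ξ ∈ boundaryOf B C → ξ' ∈ boundaryOf B C →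
      η ∈ boundaryOf B C' → η' ∈ boundaryOf B C' →
      f ξ η = f ξ' η')

/-- Membership in `C¹`: an antisymmetric integer-valued function on oriented lines
supported on at least one finite nonempty subtree of `T`. -/
def MemC1 {r : ℕ} (w : Fin r → FreeGroup B)
    (f : Boundary B → Boundary B → ℤ) : Prop :=
  Antisym B w f ∧
    ∃ X : Set (FreeGroup B), X.Finite ∧ X.Nonempty ∧ IsSubtree B X ∧
      SupportedOn1 B w f X

/-- The ball of radius `R` about a set `Y` of vertices of `T` (word metric). -/
def ballAbout (Y : Set (FreeGroup B)) (R : ℕ) : Set (FreeGroup B) :=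
  {g | ∃ y ∈ Y, (y⁻¹ * g).toWord.length ≤ R}

/-- The map `p : (ℤ[F])^k → C¹` of right `ℤ[F]`-modules determined by generators
`f j`, sending `e_j · g` to `f j · g`. -/
noncomputable def pC1 {k : ℕ} (f : Fin k → Boundary B → Boundary B → ℤ)
    (x : (Fin k × FreeGroup B) →₀ ℤ) : Boundary B → Boundary B → ℤ :=
  fun ξ η => x.sum fun p n => n * f p.1 (actB B p.2 ξ) (actB B p.2 η)

/-- `σ : ∂F → ℤ` is constant on `∂C` for every connected component `C` of `T ∖ X`. -/
def ConstOnComponents (X : Set (FreeGroup B)) (σ : Boundary B → ℤ) : Prop :=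
  ∀ C : Set (FreeGroup B), IsComponentOf B X C →
    ∀ ξ, ξ ∈ boundaryOf B C → ∀ η, η ∈ boundaryOf B C → σ ξ = σ η

/-- The shadow `S(g) ⊆ ∂F` of a nontrivial group element `g`: the boundary points
having the reduced word of `g` as an initial segment. -/
def shadow (g : FreeGroup B) : Set (Boundary B) :=
  {ξ | prefixOf B ξ g.toWord.length = g}

end DecompPaper

namespace DecompPaper

section FilteredModule

/-- If a finitely generated image `Q.map ρ` is exhausted by the images of a filtration, it is
already the image of one step of the filtration. -/
theorem exists_filtration_step_map_eq {W V : Type*} [AddCommGroup W] [AddCommGroup V]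
    (Fil : ℕ → Submodule ℤ W) (hFil : Monotone Fil) (Q : Submodule ℤ W) (ρ : W →ₗ[ℤ] V)
    (hfg : (Q.map ρ).FG) (hQ : ∀ x ∈ Q, ∃ n, x ∈ Fil n) :
    ∃ N, ∀ x ∈ Q, ∃ x' ∈ Q ⊓ Fil N, ρ x' = ρ x := by
  obtain ⟨s, hs⟩ := hfg
  have hgen : ∀ v ∈ s, ∃ n, v ∈ (Q ⊓ Fil n).map ρ := by
    intro v hv
    have hv' : v ∈ Q.map ρ := hs ▸ Submodule.subset_span hv
    obtain ⟨x, hx, rfl⟩ := hv'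
    obtain ⟨n, hn⟩ := hQ x hx
    exact ⟨n, x, ⟨hx, hn⟩, rfl⟩
  choose! n hn using hgen
  refine ⟨s.sup n, fun x hx => ?_⟩
  have hle : Q.map ρ ≤ (Q ⊓ Fil (s.sup n)).map ρ := by
    rw [← hs, Submodule.span_le]
    intro v hv
    exact Submodule.map_mono (inf_le_inf_left _ (hFil (Finset.le_sup hv))) (hn v hv)
  obtain ⟨x', hx', h⟩ := hle ⟨x, hx, rfl⟩
  exact ⟨x', hx', h⟩

/-- A filtered module `K` with operators `T b`, in which every element decomposes as a sum of
translates of elements of lower filtration that lie in the auxiliary modules `Q b`, is generated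
under the operators by one step of its filtration. -/
theorem exists_filtration_step_generates {W V ι : Type*} [AddCommGroup W] [AddCommGroup V]
    [Fintype ι] (Fil : ℕ → Submodule ℤ W) (hFil : Monotone Fil) (T : ι → W →ₗ[ℤ] W)
    (K : Submodule ℤ W) (Q : ι → Submodule ℤ W) (ρ : W →ₗ[ℤ] V)
    (hTK : ∀ b, ∀ x ∈ K, T b x ∈ K)
    (hTF : ∀ b n, ∀ x ∈ Fil n, T b x ∈ Fil (n + 1))
    (hfg : ∀ b, ((Q b).map ρ).FG)
    (hQ : ∀ b, ∀ x ∈ Q b, ∃ n, x ∈ Fil n)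
    (hK : ∀ x ∈ K, ∃ n, x ∈ Fil n)
    (hQK : ∀ b, ∀ x ∈ Q b, ρ x = 0 → x ∈ K)
    (hdec : ∀ n, 1 ≤ n → ∀ y ∈ K, y ∈ Fil (n + 1) →
      ∃ y₀ ∈ Fil 0, ∃ z : ι → W, (∀ b, z b ∈ Q b ∧ z b ∈ Fil n) ∧ y = y₀ + ∑ b, T b (z b)) :
    ∃ N, 1 ≤ N ∧ ∀ S : Submodule ℤ W, K ⊓ Fil N ≤ S → (∀ b, ∀ x ∈ S, T b x ∈ S) → K ≤ S := by
  choose N hN using fun b => exists_filtration_step_map_eq Fil hFil (Q b) ρ (hfg b) (hQ b)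
  let M := Finset.univ.sup N + 1
  have hM : ∀ b, ∀ x ∈ Q b, ∃ x' ∈ Q b ⊓ Fil M, ρ x' = ρ x := by
    intro b x hx
    obtain ⟨x', hx', h⟩ := hN b x hx
    have : N b ≤ M := (Finset.le_sup (Finset.mem_univ b)).trans (Nat.le_succ _)
    exact ⟨x', ⟨hx'.1, hFil this hx'.2⟩, h⟩
  refine ⟨M + 1, by omega, ?_⟩
  suffices H : ∀ S : Submodule ℤ W, S ≤ K → K ⊓ Fil (M + 1) ≤ S →
      (∀ b, ∀ x ∈ S, T b x ∈ S) → K ≤ S by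
    intro S hS hTS
    refine (H (S ⊓ K) inf_le_right (le_inf hS inf_le_left) ?_).trans inf_le_left
    exact fun b x hx => ⟨hTS b x hx.1, hTK b x hx.2⟩
  intro S hSK hS hTS
  have reduce : ∀ n, 1 ≤ n → (∀ b, ∀ x ∈ Q b, x ∈ Fil n → ∃ x' ∈ Q b ⊓ Fil M, x - x' ∈ S) →
      ∀ y ∈ K, y ∈ Fil (n + 1) → y ∈ S := by
    intro n hn ih y hyK hyF
    obtain ⟨y₀, hy₀, z, hz, rfl⟩ := hdec n hn y hyK hyF
    choose z' hz' hzz' using fun b => ih b (z b) (hz b).1 (hz b).2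
    have hdiff : ∑ b, T b (z b - z' b) ∈ S :=
      Submodule.sum_mem _ fun b _ => hTS b _ (hzz' b)
    have heq : y₀ + ∑ b, T b (z b) =
        (y₀ + ∑ b, T b (z' b)) + ∑ b, T b (z b - z' b) := by
      simp [map_sub, Finset.sum_sub_distrib]
    rw [heq] at hyK ⊢
    refine add_mem (hS ⟨?_, ?_⟩) hdiff
    · exact (Submodule.add_mem_iff_left K (hSK hdiff)).1 hyK
    · exact add_mem (hFil (Nat.zero_le _) hy₀)
        (Submodule.sum_mem _ fun b _ => hTF b _ _ (hz' b).2)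
  have main : ∀ n, ∀ b, ∀ x ∈ Q b, x ∈ Fil n → ∃ x' ∈ Q b ⊓ Fil M, x - x' ∈ S := by
    intro n
    induction n with
    | zero =>
      intro b x hx hxF
      exact ⟨x, ⟨hx, hFil (Nat.zero_le _) hxF⟩, by simp⟩
    | succ n ih =>
      intro b x hx hxF
      by_cases hn : n + 1 ≤ M
      · exact ⟨x, ⟨hx, hFil hn hxF⟩, by simp⟩
      · obtain ⟨x', hx', h⟩ := hM b x hx
        refine ⟨x', hx', reduce n (by omega) ih _ ?_ ?_⟩
        · exact hQK b _ (sub_mem hx hx'.1) (by rw [map_sub, h, sub_self])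
        · exact sub_mem hxF (hFil (by omega) hx'.2)
  intro y hy
  obtain ⟨n, hn⟩ := hK y hy
  exact reduce (n + 1) (by omega) (main _) y hy (hFil (by omega) hn)

end FilteredModule

section Basic

variable {B : Type}

theorem letter_inv (x : B × Bool) : (FreeGroup.mk [x])⁻¹ = FreeGroup.mk [(x.1, !x.2)] := by
  simp [FreeGroup.inv_mk, FreeGroup.invRev]

/-- Agreement of two boundary points on the first `n` letters. -/
def Agree (n : ℕ) (ξ η : Boundary B) : Prop := ∀ k < n, ξ.1 k = η.1 k

theorem Agree.mono {m n : ℕ} {ξ η : Boundary B} (h : Agree n ξ η) (hmn : m ≤ n) :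
    Agree m ξ η :=
  fun k hk => h k (hk.trans_le hmn)

end Basic

section Action

variable {B : Type} [DecidableEq B]

theorem consB_of_cancel {x : B × Bool} {ξ : Boundary B} (h : ξ.1 0 = (x.1, !x.2)) (k : ℕ) :
    (consB B x ξ).1 k = ξ.1 (k + 1) := by
  simp [consB, h]

theorem consB_zero {x : B × Bool} {ξ : Boundary B} (h : ξ.1 0 ≠ (x.1, !x.2)) :
    (consB B x ξ).1 0 = x := by
  simp [consB, h]

theorem consB_succ {x : B × Bool} {ξ : Boundary B} (h : ξ.1 0 ≠ (x.1, !x.2)) (k : ℕ) :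
    (consB B x ξ).1 (k + 1) = ξ.1 k := by
  simp [consB, h]

theorem consB_inv_consB (x : B × Bool) (ξ : Boundary B) :
    consB B (x.1, !x.2) (consB B x ξ) = ξ := by
  by_cases h : ξ.1 0 = (x.1, !x.2)
  · have h0 : (consB B x ξ).1 0 ≠ x := by
      rw [consB_of_cancel h]
      have := ξ.2 0
      rw [h] at this
      simpa using this
    apply Subtype.ext
    funext k
    cases k with
    | zero => rw [consB_zero (by simpa using h0), h]
    | succ k => rw [consB_succ (by simpa using h0), consB_of_cancel h]
  · apply Subtype.ext
    funext k
    rw [consB_of_cancel (by simp [consB_zero h]), consB_succ h]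

/-- Prepending a letter as a permutation of the boundary. -/
def consPerm (x : B × Bool) : Equiv.Perm (Boundary B) where
  toFun := consB B x
  invFun := consB B (x.1, !x.2)
  left_inv := consB_inv_consB x
  right_inv ξ := by simpa using consB_inv_consB (x.1, !x.2) ξ

/-- The action of the free group on its boundary as a homomorphism. -/
def actHom : FreeGroup B →* Equiv.Perm (Boundary B) :=
  FreeGroup.lift fun b => consPerm (b, true)

theorem actHom_mk (L : List (B × Bool)) (ξ : Boundary B) :
    actHom (FreeGroup.mk L) ξ = L.foldr (consB B) ξ := by
  induction L with
  | nil => simp [← FreeGroup.one_eq_mk]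
  | cons x L ih =>
    have hx : actHom (FreeGroup.mk [x]) = consPerm x := by
      rcases x with ⟨b, _ | _⟩
      · simp [actHom]
        rfl
      · simp [actHom]
    rw [← List.singleton_append, ← FreeGroup.mul_mk, map_mul, Equiv.Perm.mul_apply, ih, hx]
    rfl

theorem actB_eq_actHom (g : FreeGroup B) (ξ : Boundary B) : actB B g ξ = actHom g ξ := by
  rw [actB, ← actHom_mk, FreeGroup.mk_toWord]

theorem actB_mul (g h : FreeGroup B) (ξ : Boundary B) :
    actB B (g * h) ξ = actB B g (actB B h ξ) := by
  simp [actB_eq_actHom]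

theorem actB_one (ξ : Boundary B) : actB B 1 ξ = ξ := by
  simp [actB_eq_actHom]

theorem actB_letter (x : B × Bool) (ξ : Boundary B) :
    actB B (FreeGroup.mk [x]) ξ = consB B x ξ := by
  rw [actB_eq_actHom, actHom_mk]
  rfl

theorem Agree.consB_of_succ {n : ℕ} {ξ η : Boundary B} (h : Agree (n + 1) ξ η)
    (x : B × Bool) : Agree n (consB B x ξ) (consB B x η) := by
  intro k hk
  have h0 := h 0 (Nat.succ_pos n)
  by_cases hξ : ξ.1 0 = (x.1, !x.2)
  · rw [consB_of_cancel hξ, consB_of_cancel (h0 ▸ hξ), h _ (by omega)]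
  · cases k with
    | zero => rw [consB_zero hξ, consB_zero (h0 ▸ hξ)]
    | succ k => rw [consB_succ hξ, consB_succ (h0 ▸ hξ), h _ (by omega)]

theorem Agree.consB_of_ne {n : ℕ} {ξ η : Boundary B} (h : Agree n ξ η) {x : B × Bool}
    (hξ : ξ.1 0 ≠ (x.1, !x.2)) (hη : η.1 0 ≠ (x.1, !x.2)) :
    Agree (n + 1) (consB B x ξ) (consB B x η) := by
  intro k hk
  cases k with
  | zero => rw [consB_zero hξ, consB_zero hη]
  | succ k => rw [consB_succ hξ, consB_succ hη, h _ (by omega)]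

/-- Multiplication by `g` without cancellation preserves agreement of prefixes. -/
theorem Agree.actB {n : ℕ} (hn : 1 ≤ n) {ξ η : Boundary B} (h : Agree n ξ η)
    {g : FreeGroup B} (hg : ∀ x ∈ g.toWord.getLast?, ξ.1 0 ≠ (x.1, !x.2)) :
    Agree n (actB B g ξ) (actB B g η) := by
  have key : ∀ L : List (B × Bool), FreeGroup.IsReduced L →
      (∀ x ∈ L.getLast?, ξ.1 0 ≠ (x.1, !x.2)) →
      Agree n (L.foldr (consB B) ξ) (L.foldr (consB B) η) ∧
        (L.foldr (consB B) ξ).1 0 = L.head?.getD (ξ.1 0) := by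
    intro L
    induction L with
    | nil => exact fun _ _ => ⟨h, rfl⟩
    | cons x L ih =>
      intro hred hlast
      have hred' : FreeGroup.IsReduced L := by
        cases L with
        | nil => simp [FreeGroup.IsReduced]
        | cons y L => exact (FreeGroup.isReduced_cons_cons.1 hred).2
      have hne : L.head?.getD (ξ.1 0) ≠ (x.1, !x.2) := by
        cases L with
        | nil => exact hlast x (by simp)
        | cons y L =>
          have := (FreeGroup.isReduced_cons_cons.1 hred).1
          intro hy
          have hy' : y = (x.1, !x.2) := hy
          subst hy'
          simp at this
      have hlast' : ∀ y ∈ L.getLast?, ξ.1 0 ≠ (y.1, !y.2) := by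
        intro y hy
        apply hlast
        cases L with
        | nil => simp at hy
        | cons z L => simpa [List.getLast?_cons_cons] using hy
      obtain ⟨hagree, hhead⟩ := ih hred' hlast'
      rw [← hhead] at hne
      have hne' := hne
      rw [hagree 0 (by omega)] at hne'
      exact ⟨(hagree.consB_of_ne hne hne').mono (Nat.le_succ n), consB_zero hne⟩
  exact (key g.toWord FreeGroup.isReduced_toWord hg).1

end Action

section Words

variable {B : Type} [DecidableEq B]

theorem toWord_mk_of_isReduced {L : List (B × Bool)} (h : FreeGroup.IsReduced L) :
    (FreeGroup.mk L).toWord = L := by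
  rw [FreeGroup.toWord_mk, h.reduce_eq]

theorem toWord_letter_mul_of_cancel {x : B × Bool} {g : FreeGroup B} {L : List (B × Bool)}
    (h : g.toWord = (x.1, !x.2) :: L) : (FreeGroup.mk [x] * g).toWord = L := by
  have hL : FreeGroup.IsReduced L := by
    have hg : FreeGroup.IsReduced g.toWord := FreeGroup.isReduced_toWord
    rw [h] at hg
    exact hg.infix ((List.suffix_cons _ _).isInfix)
  have hg : g = (FreeGroup.mk [x])⁻¹ * FreeGroup.mk L := by
    rw [letter_inv, FreeGroup.mul_mk, List.singleton_append, ← h, FreeGroup.mk_toWord]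
  rw [hg, mul_inv_cancel_left, toWord_mk_of_isReduced hL]

theorem toWord_letter_mul_of_ne {x : B × Bool} {g : FreeGroup B}
    (h : (x.1, !x.2) ∉ g.toWord.head?) :
    (FreeGroup.mk [x] * g).toWord = x :: g.toWord := by
  have hred : FreeGroup.IsReduced (x :: g.toWord) := by
    have hg : FreeGroup.IsReduced g.toWord := FreeGroup.isReduced_toWord
    cases hw : g.toWord with
    | nil => simp [FreeGroup.IsReduced]
    | cons y L =>
      rw [hw] at h hg
      refine FreeGroup.isReduced_cons_cons.2 ⟨fun h1 => ?_, hg⟩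
      by_contra h2
      refine h ?_
      rcases x with ⟨x, _ | _⟩ <;> rcases y with ⟨y, _ | _⟩ <;> simp_all
  conv_lhs => rw [← FreeGroup.mk_toWord (x := g), FreeGroup.mul_mk, List.singleton_append]
  exact toWord_mk_of_isReduced hred

theorem getLast?_toWord_inv (g : FreeGroup B) :
    g⁻¹.toWord.getLast? = g.toWord.head?.map fun x => (x.1, !x.2) := by
  rw [FreeGroup.toWord_inv, FreeGroup.invRev, List.getLast?_reverse, List.head?_map]

theorem head?_toWord_inv (g : FreeGroup B) :
    g⁻¹.toWord.head? = g.toWord.getLast?.map fun x => (x.1, !x.2) := by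
  rw [FreeGroup.toWord_inv, FreeGroup.invRev, List.head?_reverse, List.getLast?_map]

/-- Right multiplication by a letter cancelling the last letter. -/
theorem toWord_mul_letter_of_cancel {x : B × Bool} {g : FreeGroup B}
    (h : (x.1, !x.2) ∈ g.toWord.getLast?) :
    (g * FreeGroup.mk [x]).norm + 1 = g.norm ∧
      x ∉ (g * FreeGroup.mk [x]).toWord.getLast? := by
  obtain ⟨L, hL⟩ := List.getLast?_eq_some_iff.1 (Option.mem_def.1 h)
  have hg : FreeGroup.IsReduced g.toWord := FreeGroup.isReduced_toWord
  have hred : FreeGroup.IsReduced L := by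
    rw [hL] at hg
    exact hg.infix (List.prefix_append _ _).isInfix
  have hmul : g = FreeGroup.mk L * (FreeGroup.mk [x])⁻¹ := by
    rw [letter_inv, FreeGroup.mul_mk, ← hL, FreeGroup.mk_toWord]
  have hw : (g * FreeGroup.mk [x]).toWord = L := by
    rw [hmul, inv_mul_cancel_right, toWord_mk_of_isReduced hred]
  refine ⟨by simp [FreeGroup.norm, hw, hL], fun hx => ?_⟩
  rw [hw] at hx
  obtain ⟨L', rfl⟩ := List.getLast?_eq_some_iff.1 (Option.mem_def.1 hx)
  rw [hL] at hg
  have := hg.infix (L₁ := [x, (x.1, !x.2)]) ⟨L', [], by simp⟩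
  simp [FreeGroup.isReduced_cons_cons] at this

/-- Right multiplication by a letter not cancelling the last letter. -/
theorem getLast?_toWord_mul_letter_of_ne {x : B × Bool} {g : FreeGroup B}
    (h : (x.1, !x.2) ∉ g.toWord.getLast?) :
    (g * FreeGroup.mk [x]).toWord.getLast? = some x := by
  by_contra hne
  have hw := toWord_letter_mul_of_ne (x := (x.1, !x.2)) (g := g⁻¹) (by
    rw [head?_toWord_inv]
    rintro hx
    obtain ⟨y, hy, hyx⟩ := Option.map_eq_some_iff.1 hx
    refine h ?_
    rw [Option.mem_def, hy]
    simp only [Prod.mk.injEq, Bool.not_not] at hyx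
    simp [← hyx.1, ← hyx.2])
  have heq : FreeGroup.mk [(x.1, !x.2)] * g⁻¹ = (g * FreeGroup.mk [x])⁻¹ := by
    rw [mul_inv_rev, letter_inv]
  rw [heq] at hw
  have := getLast?_toWord_inv (g * FreeGroup.mk [x])⁻¹
  rw [inv_inv, hw] at this
  simp at this
  exact hne this

/-- If the reduced words of `u` and `v` do not start with the same letter, then the geodesic
from `u` to `v` passes through the identity, so `v` is no longer than `u⁻¹ * v`. -/
theorem norm_le_norm_inv_mul {u v : FreeGroup B} {x : B × Bool}
    (hv : v.toWord.head? = some x) (hu : u.toWord.head? ≠ some x) :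
    v.norm ≤ (u⁻¹ * v).norm := by
  have hred : FreeGroup.IsReduced (u⁻¹.toWord ++ v.toWord) := by
    refine List.IsChain.append FreeGroup.isReduced_toWord FreeGroup.isReduced_toWord ?_
    intro a ha b hb
    rw [getLast?_toWord_inv] at ha
    obtain ⟨y, hy, rfl⟩ := Option.map_eq_some_iff.1 ha
    rw [hv] at hb
    obtain rfl : x = b := by simpa using hb
    intro h1
    by_contra h2
    apply hu
    rw [hy]
    rcases x with ⟨x, _ | _⟩ <;> rcases y with ⟨y, _ | _⟩ <;> simp_all
  rw [FreeGroup.norm, FreeGroup.norm, FreeGroup.toWord_mul, hred.reduce_eq, List.length_append]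
  omega

end Words

section Lines

variable {B : Type} [DecidableEq B]

theorem TendstoBoundary.letter_mul {a : ℕ → FreeGroup B} {ξ : Boundary B}
    (h : TendstoBoundary B a ξ) (x : B × Bool) :
    TendstoBoundary B (fun k => FreeGroup.mk [x] * a k) (consB B x ξ) := by
  intro m
  obtain ⟨K, hK⟩ := h (m + 1)
  refine ⟨K, fun k hk => ?_⟩
  obtain ⟨t, ht⟩ := hK k hk
  rw [List.ofFn_succ] at ht
  by_cases hx : ξ.1 0 = (x.1, !x.2)
  · have ht' : (a k).toWord = (x.1, !x.2) :: ((List.ofFn fun i : Fin m => ξ.1 (i + 1)) ++ t) := by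
      rw [← ht, ← hx]
      rfl
    rw [toWord_letter_mul_of_cancel ht']
    refine ⟨t, ?_⟩
    congr 2
    funext i
    rw [consB_of_cancel hx]
  · have hne : (x.1, !x.2) ∉ (a k).toWord.head? := by
      rw [← ht]
      simpa using hx
    rw [toWord_letter_mul_of_ne hne]
    cases m with
    | zero => simp
    | succ m =>
      rw [List.ofFn_succ]
      have h0 : (consB B x ξ).1 ((0 : Fin (m + 1)) : ℕ) = x := consB_zero hx
      rw [h0, List.cons_prefix_cons]
      refine ⟨rfl, ?_⟩
      obtain ⟨t, ht⟩ := hK k hk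
      have : (List.ofFn fun i : Fin m => (consB B x ξ).1 (i.succ : ℕ)) =
          (List.ofFn fun i : Fin (m + 1 + 1) => ξ.1 i).take m := by
        apply List.ext_getElem
        · simp; omega
        · intro i h1 h2
          simp only [List.getElem_ofFn, List.getElem_take, Fin.val_succ, consB_succ hx]
      rw [this, ← ht]
      exact (List.take_prefix _ _).trans (List.prefix_append _ _)

theorem TendstoBoundary.mul_left {a : ℕ → FreeGroup B} {ξ : Boundary B}
    (h : TendstoBoundary B a ξ) (g : FreeGroup B) :
    TendstoBoundary B (fun k => g * a k) (actB B g ξ) := by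
  have key : ∀ L : List (B × Bool),
      TendstoBoundary B (fun k => FreeGroup.mk L * a k) (L.foldr (consB B) ξ) := by
    intro L
    induction L with
    | nil => simpa [← FreeGroup.one_eq_mk] using h
    | cons x L ih =>
      have := ih.letter_mul x
      simp only [← mul_assoc, FreeGroup.mul_mk, List.singleton_append] at this
      exact this
  have := key g.toWord
  rw [FreeGroup.mk_toWord] at this
  exact this

theorem TendstoBoundary.unique {a : ℕ → FreeGroup B} {ξ η : Boundary B}
    (hξ : TendstoBoundary B a ξ) (hη : TendstoBoundary B a η) : ξ = η := by
  apply Subtype.ext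
  funext m
  obtain ⟨K, hK⟩ := hξ (m + 1)
  obtain ⟨K', hK'⟩ := hη (m + 1)
  have h := List.prefix_of_prefix_length_le (hK _ (le_max_left K K')) (hK' _ (le_max_right K K'))
    (by simp)
  have h' := List.ofFn_injective (h.eq_of_length (by simp))
  exact congrFun h' (Fin.last m)

theorem TendstoBoundary.head?_eq {a : ℕ → FreeGroup B} {ξ : Boundary B}
    (h : TendstoBoundary B a ξ) : ∃ K, ∀ k, K ≤ k → (a k).toWord.head? = some (ξ.1 0) := by
  obtain ⟨K, hK⟩ := h 1
  refine ⟨K, fun k hk => ?_⟩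
  obtain ⟨t, ht⟩ := hK k hk
  rw [← ht]
  simp

/-- The limit of `g * u ^ k` does not change when `g` is replaced by `g * u ^ j`. -/
theorem TendstoBoundary.mul_zpow {g u : FreeGroup B} {ξ : Boundary B}
    (h : TendstoBoundary B (fun k => g * u ^ k) ξ) (j : ℤ) :
    TendstoBoundary B (fun k => g * u ^ j * u ^ k) ξ := by
  intro m
  obtain ⟨K, hK⟩ := h m
  refine ⟨K + j.natAbs, fun k hk => ?_⟩
  have hjk : (((j + k).toNat : ℕ) : ℤ) = j + k := Int.toNat_of_nonneg (by omega)
  have := hK (j + k).toNat (by omega)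
  beta_reduce at this
  rw [← zpow_natCast u (j + k).toNat, hjk, zpow_add, zpow_natCast, ← mul_assoc] at this
  exact this

/-- If the two limits of `g * u ^ k` start with different letters, then some `g * u ^ j` is no
longer than `u`. -/
theorem exists_norm_mul_zpow_le {g u : FreeGroup B} {ξ η : Boundary B}
    (hξ : TendstoBoundary B (fun k => g * u ^ k) ξ)
    (hη : TendstoBoundary B (fun k => g * u⁻¹ ^ k) η) (hne : ξ.1 0 ≠ η.1 0) :
    ∃ j : ℤ, (g * u ^ j).norm ≤ u.norm := by
  obtain ⟨K, hK⟩ := hξ.head?_eq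
  obtain ⟨K', hK'⟩ := hη.head?_eq
  by_contra! hlong
  have hstep : ∀ n : ℕ, (g * u ^ ((K : ℤ) - n)).toWord.head? = some (ξ.1 0) := by
    intro n
    induction n with
    | zero => simpa using hK K le_rfl
    | succ n ih =>
      by_contra hu
      have := norm_le_norm_inv_mul ih hu
      have heq : (g * u ^ ((K : ℤ) - (n + 1 : ℕ)))⁻¹ * (g * u ^ ((K : ℤ) - n)) = u := by
        rw [mul_inv_rev, mul_assoc, inv_mul_cancel_left, ← zpow_neg, ← zpow_add]
        convert zpow_one u using 2
        push_cast
        ring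
      rw [heq] at this
      exact absurd (hlong _) (not_lt.2 this)
  have h1 := hstep (K + K')
  have h2 := hK' K' le_rfl
  have heq : (K : ℤ) - (K + K' : ℕ) = -(K' : ℤ) := by push_cast; ring
  rw [heq, zpow_neg, zpow_natCast, ← inv_pow, h2] at h1
  exact hne (Option.some_injective _ h1).symm

variable {r : ℕ} {w : Fin r → FreeGroup B}

theorem IsLine.symm {ξ η : Boundary B} (h : IsLine B w ξ η) : IsLine B w η ξ := by
  obtain ⟨g, i, h | h⟩ := h
  · exact ⟨g, i, Or.inr h⟩
  · exact ⟨g, i, Or.inl h⟩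

theorem IsLine.actB {ξ η : Boundary B} (h : IsLine B w ξ η) (g : FreeGroup B) :
    IsLine B w (actB B g ξ) (actB B g η) := by
  obtain ⟨g', i, h | h⟩ := h
  · refine ⟨g * g', i, Or.inl ?_⟩
    simpa only [mul_assoc] using And.intro (h.1.mul_left g) (h.2.mul_left g)
  · refine ⟨g * g', i, Or.inr ?_⟩
    simpa only [mul_assoc] using And.intro (h.1.mul_left g) (h.2.mul_left g)

theorem finite_norm_le [Finite B] (n : ℕ) : {g : FreeGroup B | g.norm ≤ n}.Finite := by
  refine ((List.finite_length_le (B × Bool) n).image FreeGroup.mk).subset ?_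
  exact fun g hg => ⟨g.toWord, hg, FreeGroup.mk_toWord⟩

/-- Only finitely many boundary points are endpoints of lines through the identity. -/
theorem finite_crossing_endpoints [Finite B] (w : Fin r → FreeGroup B) :
    {η : Boundary B | ∃ ξ, IsLine B w ξ η ∧ ξ.1 0 ≠ η.1 0}.Finite := by
  let E : Fin r → FreeGroup B → Set (Boundary B) := fun i g =>
    {η | TendstoBoundary B (fun k => g * w i ^ k) η} ∪
      {η | TendstoBoundary B (fun k => g * (w i)⁻¹ ^ k) η}
  have hfin : (⋃ i, ⋃ g ∈ {g : FreeGroup B | g.norm ≤ (w i).norm}, E i g).Finite := by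
    refine Set.finite_iUnion fun i => (finite_norm_le _).biUnion fun g _ => ?_
    exact Set.Finite.union (Set.Subsingleton.finite fun _ h _ h' => h.unique h')
      (Set.Subsingleton.finite fun _ h _ h' => h.unique h')
  refine hfin.subset ?_
  rintro η ⟨ξ, ⟨g, i, ⟨h1, h2⟩ | ⟨h1, h2⟩⟩, hne⟩
  · obtain ⟨j, hj⟩ := exists_norm_mul_zpow_le h1 h2 hne
    have := h2.mul_zpow (-j)
    rw [inv_zpow', neg_neg] at this
    exact Set.mem_iUnion.2 ⟨i, Set.mem_biUnion hj (Or.inr this)⟩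
  · obtain ⟨j, hj⟩ := exists_norm_mul_zpow_le h1 h2 hne.symm
    exact Set.mem_iUnion.2 ⟨i, Set.mem_biUnion hj (Or.inl (h1.mul_zpow j))⟩

end Lines

section Functions

variable {B : Type}

instance : DiscreteTopology (B × Bool) := ⟨rfl⟩

variable (B) in
/-- The functions on the boundary depending only on the first `n` letters. -/
def levelFunctions (n : ℕ) : Submodule ℤ (Boundary B → ℤ) where
  carrier := {f | ∀ ξ η, Agree n ξ η → f ξ = f η}
  zero_mem' := fun _ _ _ => rfl
  add_mem' := fun hf hg ξ η h => congrArg₂ (· + ·) (hf ξ η h) (hg ξ η h)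
  smul_mem' := fun c _ hf ξ η h => congrArg (c • ·) (hf ξ η h)

theorem levelFunctions_mono : Monotone (levelFunctions B) :=
  fun _ _ hmn _ hf ξ η h => hf ξ η (h.mono hmn)

variable (B) in
/-- Pullback of functions along the restriction to the first `n` letters. -/
def levelPullback (n : ℕ) : ((Fin n → B × Bool) → ℤ) →ₗ[ℤ] (Boundary B → ℤ) :=
  LinearMap.funLeft ℤ ℤ fun ξ i => ξ.1 i

theorem levelFunctions_le_range (n : ℕ) :
    levelFunctions B n ≤ LinearMap.range (levelPullback B n) := by
  intro f hf
  have hfac : f.FactorsThrough fun (ξ : Boundary B) (i : Fin n) => ξ.1 i :=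
    fun ξ η h => hf ξ η fun k hk => congrFun h ⟨k, hk⟩
  refine ⟨Function.extend (fun (ξ : Boundary B) (i : Fin n) => ξ.1 i) f 0, ?_⟩
  funext ξ
  exact hfac.extend_apply 0 ξ

theorem fg_of_le_range {M N : Type*} [AddCommGroup M] [AddCommGroup N] [IsNoetherian ℤ M]
    {φ : M →ₗ[ℤ] N} {S : Submodule ℤ N} (h : S ≤ LinearMap.range φ) : S.FG := by
  rw [← Submodule.map_comap_eq_of_le h]
  exact (IsNoetherian.noetherian _).map φ

theorem fg_of_le_levelFunctions [Finite B] {n : ℕ} {S : Submodule ℤ (Boundary B → ℤ)}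
    (h : S ≤ levelFunctions B n) : S.FG :=
  fg_of_le_range (h.trans (levelFunctions_le_range n))

theorem continuous_of_mem_levelFunctions {n : ℕ} {f : Boundary B → ℤ}
    (hf : f ∈ levelFunctions B n) : Continuous f := by
  obtain ⟨φ, rfl⟩ := levelFunctions_le_range n hf
  have hres : Continuous fun (ξ : Boundary B) (i : Fin n) => ξ.1 i :=
    continuous_pi fun i => (continuous_apply _).comp continuous_subtype_val
  exact (continuous_of_discreteTopology (f := φ)).comp hres

instance [Finite B] : CompactSpace (Boundary B) := by
  have hclosed : IsClosed {s : ℕ → B × Bool | ∀ k, s (k + 1) ≠ ((s k).1, !(s k).2)} := by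
    rw [Set.ofPred_forall]
    refine isClosed_iInter fun k => ?_
    have hcont : Continuous fun s : ℕ → B × Bool => (s (k + 1), s k) := by fun_prop
    exact (isClosed_discrete
      {p : (B × Bool) × (B × Bool) | p.1 ≠ (p.2.1, !p.2.2)}).preimage hcont
  exact isCompact_iff_compactSpace.1 hclosed.isCompact

theorem exists_mem_levelFunctions_of_continuous [Finite B] {f : Boundary B → ℤ}
    (hf : Continuous f) : ∃ n, f ∈ levelFunctions B n := by
  by_contra! hcon
  let C : ℕ → Set (Boundary B × Boundary B) := fun n => {p | Agree n p.1 p.2 ∧ f p.1 ≠ f p.2}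
  have hclosed : ∀ n, IsClosed (C n) := by
    intro n
    refine IsClosed.inter (s₁ := {p : Boundary B × Boundary B | Agree n p.1 p.2}) ?_ ?_
    · simp only [Agree, Set.ofPred_forall]
      refine isClosed_iInter fun k => isClosed_iInter fun _ => ?_
      exact isClosed_eq ((continuous_apply k).comp (continuous_subtype_val.comp continuous_fst))
        ((continuous_apply k).comp (continuous_subtype_val.comp continuous_snd))
    · have hcont : Continuous fun p : Boundary B × Boundary B => (f p.1, f p.2) := by fun_prop
      exact (isClosed_discrete {q : ℤ × ℤ | q.1 ≠ q.2}).preimage hcont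
  have hne : ∀ n, (C n).Nonempty := by
    intro n
    have h : ¬∀ ξ η, Agree n ξ η → f ξ = f η := hcon n
    push Not at h
    obtain ⟨ξ, η, h⟩ := h
    exact ⟨(ξ, η), h⟩
  obtain ⟨⟨ξ, η⟩, h⟩ := IsCompact.nonempty_iInter_of_sequence_nonempty_isCompact_isClosed C
    (fun n p hp => ⟨hp.1.mono (Nat.le_succ n), hp.2⟩) hne (hclosed 0).isCompact hclosed
  have h' := Set.mem_iInter.1 h
  refine (h' 0).2 (congrArg f (Subtype.ext (funext fun k => ?_)))
  exact (h' (k + 1)).1 k (Nat.lt_succ_self k)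

end Functions

section Invariants

variable {B : Type} [DecidableEq B] {r : ℕ}

/-- The locally constant functions on the boundary taking equal values at the two endpoints of
each line. -/
def invariantFunctions (w : Fin r → FreeGroup B) : Submodule ℤ (Boundary B → ℤ) where
  carrier := {f | (∃ n, f ∈ levelFunctions B n) ∧ ∀ ξ η, IsLine B w ξ η → f ξ = f η}
  zero_mem' := ⟨⟨0, zero_mem _⟩, fun _ _ _ => rfl⟩
  add_mem' := by
    rintro f g ⟨⟨m, hf⟩, hf'⟩ ⟨⟨n, hg⟩, hg'⟩
    refine ⟨⟨max m n, add_mem (levelFunctions_mono (le_max_left m n) hf)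
      (levelFunctions_mono (le_max_right m n) hg)⟩, fun ξ η h => ?_⟩
    exact congrArg₂ (· + ·) (hf' ξ η h) (hg' ξ η h)
  smul_mem' := by
    rintro c f ⟨⟨n, hf⟩, hf'⟩
    exact ⟨⟨n, Submodule.smul_mem _ c hf⟩, fun ξ η h => congrArg (c • ·) (hf' ξ η h)⟩

/-- The locally constant functions vanishing on the words that start with `b⁻¹` and taking equal
values at the two endpoints of each line neither of whose endpoints starts with `b⁻¹`. -/
def halfInvariantFunctions (w : Fin r → FreeGroup B) (b : B × Bool) :
    Submodule ℤ (Boundary B → ℤ) where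
  carrier := {f | (∃ n, f ∈ levelFunctions B n) ∧ (∀ ξ, ξ.1 0 = (b.1, !b.2) → f ξ = 0) ∧
    ∀ ξ η, IsLine B w ξ η → ξ.1 0 ≠ (b.1, !b.2) → η.1 0 ≠ (b.1, !b.2) → f ξ = f η}
  zero_mem' := ⟨⟨0, zero_mem _⟩, fun _ _ => rfl, fun _ _ _ _ _ => rfl⟩
  add_mem' := by
    rintro f g ⟨⟨m, hf⟩, hf₀, hf'⟩ ⟨⟨n, hg⟩, hg₀, hg'⟩
    refine ⟨⟨max m n, add_mem (levelFunctions_mono (le_max_left m n) hf)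
      (levelFunctions_mono (le_max_right m n) hg)⟩, fun ξ h => ?_, fun ξ η h h₁ h₂ => ?_⟩
    · simp [hf₀ ξ h, hg₀ ξ h]
    · exact congrArg₂ (· + ·) (hf' ξ η h h₁ h₂) (hg' ξ η h h₁ h₂)
  smul_mem' := by
    rintro c f ⟨⟨n, hf⟩, hf₀, hf'⟩
    refine ⟨⟨n, Submodule.smul_mem _ c hf⟩, fun ξ h => ?_, fun ξ η h h₁ h₂ => ?_⟩
    · simp [hf₀ ξ h]
    · exact congrArg (c • ·) (hf' ξ η h h₁ h₂)

/-- Translation of functions by a group element. -/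
def translateFun (g : FreeGroup B) : (Boundary B → ℤ) →ₗ[ℤ] (Boundary B → ℤ) :=
  LinearMap.funLeft ℤ ℤ (actB B g)

theorem translateFun_apply (g : FreeGroup B) (f : Boundary B → ℤ) (ξ : Boundary B) :
    translateFun g f ξ = f (actB B g ξ) := rfl

theorem translateFun_letter_inv_apply (b : B × Bool) (f : Boundary B → ℤ) (ξ : Boundary B) :
    translateFun (FreeGroup.mk [b])⁻¹ f ξ = f (consB B (b.1, !b.2) ξ) := by
  rw [translateFun_apply, letter_inv, actB_letter]

theorem translateFun_letter_mem_levelFunctions (b : B × Bool) (n : ℕ) {f : Boundary B → ℤ}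
    (hf : f ∈ levelFunctions B n) :
    translateFun (FreeGroup.mk [b])⁻¹ f ∈ levelFunctions B (n + 1) := by
  intro ξ η h
  rw [translateFun_letter_inv_apply, translateFun_letter_inv_apply]
  exact hf _ _ (h.consB_of_succ _)

/-- The invariant functions are generated, under translation, by those of some bounded level. -/
theorem exists_level_generates_invariantFunctions [Fintype B] (w : Fin r → FreeGroup B) :
    ∃ N, 1 ≤ N ∧ ∀ S : Submodule ℤ (Boundary B → ℤ),
      invariantFunctions w ⊓ levelFunctions B N ≤ S →
      (∀ b, ∀ f ∈ S, translateFun (FreeGroup.mk [b])⁻¹ f ∈ S) → invariantFunctions w ≤ S := by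
  classical
  let E := {η : Boundary B | ∃ ξ, IsLine B w ξ η ∧ ξ.1 0 ≠ η.1 0}
  have : Finite E := finite_crossing_endpoints w
  let ρ : (Boundary B → ℤ) →ₗ[ℤ] (E → ℤ) := LinearMap.funLeft ℤ ℤ Subtype.val
  refine exists_filtration_step_generates (levelFunctions B) levelFunctions_mono
    (fun b => translateFun (FreeGroup.mk [b])⁻¹) (invariantFunctions w)
    (halfInvariantFunctions w) ρ ?_ ?_ ?_ ?_ ?_ ?_ ?_
  · rintro b f ⟨⟨n, hf⟩, hf'⟩
    exact ⟨⟨n + 1, translateFun_letter_mem_levelFunctions b n hf⟩,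
      fun ξ η h => hf' _ _ (h.actB _)⟩
  · exact fun b n f hf => translateFun_letter_mem_levelFunctions b n hf
  · exact fun b => IsNoetherian.noetherian _
  · exact fun b f hf => hf.1
  · exact fun f hf => hf.1
  · rintro b f ⟨hf, hf₀, hf'⟩ hρ
    have hE : ∀ ξ η, IsLine B w ξ η → ξ.1 0 ≠ η.1 0 → f η = 0 :=
      fun ξ η h hne => congrFun hρ ⟨η, ξ, h, hne⟩
    refine ⟨hf, fun ξ η h => ?_⟩
    by_cases hne : ξ.1 0 = η.1 0
    · by_cases hb : ξ.1 0 = (b.1, !b.2)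
      · rw [hf₀ ξ hb, hf₀ η (hne ▸ hb)]
      · exact hf' ξ η h hb (hne ▸ hb)
    · rw [hE ξ η h hne, hE η ξ h.symm (Ne.symm hne)]
  · rintro n hn f ⟨-, hf'⟩ hfn
    refine ⟨0, zero_mem _, fun b ξ => if ξ.1 0 = (b.1, !b.2) then 0 else f (consB B b ξ),
      fun b => ?_, ?_⟩
    · have hlev : (fun ξ : Boundary B => if ξ.1 0 = (b.1, !b.2) then 0 else f (consB B b ξ)) ∈
          levelFunctions B n := by
        intro ξ η h
        have h0 := h 0 hn
        by_cases hb : ξ.1 0 = (b.1, !b.2)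
        · simp [hb, h0 ▸ hb]
        · have hb' : η.1 0 ≠ (b.1, !b.2) := h0 ▸ hb
          simp only [hb, hb', if_false]
          exact hfn _ _ (h.consB_of_ne hb hb')
      refine ⟨⟨⟨n, hlev⟩, fun ξ h => by simp [h], fun ξ η h h₁ h₂ => ?_⟩, hlev⟩
      simp only [h₁, h₂, if_false]
      rw [← actB_letter, ← actB_letter]
      exact hf' _ _ (h.actB _)
    · funext ξ
      rw [zero_add, Finset.sum_apply, Finset.sum_eq_single (ξ.1 0)]
      · rw [translateFun_letter_inv_apply]
        have hcancel := consB_of_cancel (x := ((ξ.1 0).1, !(ξ.1 0).2)) (ξ := ξ) (by simp) 0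
        beta_reduce
        rw [if_neg (by rw [hcancel]; exact ξ.2 0)]
        have := consB_inv_consB ((ξ.1 0).1, !(ξ.1 0).2) ξ
        simp only [Bool.not_not, Prod.mk.eta] at this
        rw [this]
      · intro b _ hb
        rw [translateFun_letter_inv_apply]
        beta_reduce
        rw [if_pos]
        exact consB_zero (by simpa using hb.symm)
      · simp

end Invariants

section FreeModule

variable {B : Type} {k : ℕ}

/-- Right translation on the free module as a linear map. -/
noncomputable def translateFree (g : FreeGroup B) :
    ((Fin k × FreeGroup B) →₀ ℤ) →ₗ[ℤ] ((Fin k × FreeGroup B) →₀ ℤ) :=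
  Finsupp.lmapDomain ℤ ℤ fun p => (p.1, p.2 * g)

theorem translateFree_translateFree (g h : FreeGroup B) (x : (Fin k × FreeGroup B) →₀ ℤ) :
    translateFree h (translateFree g x) = translateFree (g * h) x := by
  simp only [translateFree, Finsupp.lmapDomain_apply, ← Finsupp.mapDomain_comp]
  congr 1
  funext p
  simp [mul_assoc]

theorem translateFree_one (x : (Fin k × FreeGroup B) →₀ ℤ) : translateFree 1 x = x := by
  simp only [translateFree, Finsupp.lmapDomain_apply, mul_one, Prod.mk.eta]
  exact Finsupp.mapDomain_id

end FreeModule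

section Relations

variable {B : Type} [DecidableEq B] {k : ℕ}

/-- The module map determined by generators `σ j` of a module of functions on the boundary. -/
noncomputable def generatorMap (σ : Fin k → Boundary B → ℤ) :
    ((Fin k × FreeGroup B) →₀ ℤ) →ₗ[ℤ] (Boundary B → ℤ) :=
  Finsupp.linearCombination ℤ fun p ξ => σ p.1 (actB B p.2 ξ)

theorem generatorMap_apply (σ : Fin k → Boundary B → ℤ) (x : (Fin k × FreeGroup B) →₀ ℤ)
    (ξ : Boundary B) :
    generatorMap σ x ξ = x.sum fun p n => n * σ p.1 (actB B p.2 ξ) := by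
  simp [generatorMap, Finsupp.linearCombination_apply, Finsupp.sum, Finset.sum_apply]

theorem generatorMap_translateFree (σ : Fin k → Boundary B → ℤ) (g : FreeGroup B)
    (x : (Fin k × FreeGroup B) →₀ ℤ) :
    generatorMap σ (translateFree g x) = translateFun g (generatorMap σ x) := by
  rw [generatorMap, translateFree, Finsupp.lmapDomain_apply, Finsupp.linearCombination_mapDomain,
    Finsupp.linearCombination_apply, Finsupp.linearCombination_apply, Finsupp.sum, Finsupp.sum,
    map_sum]
  refine Finset.sum_congr rfl fun p _ => ?_
  rw [map_smul]
  congr 1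
  funext ξ
  simp [translateFun_apply, actB_mul]

/-- A translate of `σ` takes equal values at two points agreeing on sufficiently many letters,
for an element of the free module whose terms do not cancel against them. -/
theorem generatorMap_eq_of_agree {n : ℕ} (hn : 1 ≤ n) {σ : Fin k → Boundary B → ℤ}
    (hσ : ∀ j, σ j ∈ levelFunctions B n) {x : (Fin k × FreeGroup B) →₀ ℤ} {ξ η : Boundary B}
    (h : Agree n ξ η)
    (hx : ∀ p ∈ x.support, ∀ y ∈ p.2.toWord.getLast?, ξ.1 0 ≠ (y.1, !y.2)) :
    generatorMap σ x ξ = generatorMap σ x η := by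
  rw [generatorMap_apply, generatorMap_apply]
  refine Finset.sum_congr rfl fun p hp => ?_
  beta_reduce
  rw [hσ p.1 _ _ (h.actB hn (hx p hp))]

/-- The elements of the free module supported on group elements of length at most `n`. -/
noncomputable def ballFree (B : Type) [DecidableEq B] (k n : ℕ) :
    Submodule ℤ ((Fin k × FreeGroup B) →₀ ℤ) :=
  Finsupp.supported ℤ ℤ {p | p.2.norm ≤ n}

theorem mem_ballFree {n : ℕ} {x : (Fin k × FreeGroup B) →₀ ℤ} :
    x ∈ ballFree B k n ↔ ∀ p ∈ x.support, p.2.norm ≤ n := by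
  rw [ballFree, Finsupp.mem_supported]
  rfl

theorem ballFree_mono : Monotone (ballFree B k) :=
  fun _ _ hmn => Finsupp.supported_mono fun _ hp => le_trans hp hmn

theorem fg_of_le_ballFree [Finite B] {n : ℕ} {S : Submodule ℤ ((Fin k × FreeGroup B) →₀ ℤ)}
    (h : S ≤ ballFree B k n) : S.FG := by
  have hfin : {p : Fin k × FreeGroup B | p.2.norm ≤ n}.Finite := by
    refine (Set.finite_univ.prod (finite_norm_le (B := B) n)).subset ?_
    exact fun p hp => ⟨Set.mem_univ _, hp⟩
  have := hfin.to_subtype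
  let φ := Finsupp.lmapDomain ℤ ℤ (Subtype.val : {p : Fin k × FreeGroup B | p.2.norm ≤ n} → _)
  refine fg_of_le_range (φ := φ) (h.trans ?_)
  rw [ballFree, Finsupp.range_lmapDomain, Finsupp.supported_eq_span_single]
  refine Submodule.span_mono ?_
  rintro _ ⟨p, hp, rfl⟩
  exact ⟨⟨p, hp⟩, rfl⟩

theorem exists_mem_ballFree (x : (Fin k × FreeGroup B) →₀ ℤ) : ∃ n, x ∈ ballFree B k n :=
  ⟨x.support.sup fun p => p.2.norm,
    mem_ballFree.2 fun _ hp => Finset.le_sup (f := fun p => FreeGroup.norm p.2) hp⟩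

theorem support_translateFree {g : FreeGroup B} {x : (Fin k × FreeGroup B) →₀ ℤ}
    {p : Fin k × FreeGroup B} (hp : p ∈ (translateFree g x).support) :
    ∃ q ∈ x.support, p = (q.1, q.2 * g) := by
  classical
  have := Finsupp.mapDomain_support hp
  obtain ⟨q, hq, rfl⟩ := Finset.mem_image.1 this
  exact ⟨q, hq, rfl⟩

/-- The elements of the free module supported on group elements not ending with `b` and mapped
to functions of level `n`. -/
noncomputable def halfFree (σ : Fin k → Boundary B → ℤ) (n : ℕ) (b : B × Bool) :
    Submodule ℤ ((Fin k × FreeGroup B) →₀ ℤ) :=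
  Finsupp.supported ℤ ℤ {p | b ∉ p.2.toWord.getLast?} ⊓
    (levelFunctions B n).comap (generatorMap σ)

/-- The terms of a relation that end with `b⁻¹`, translated by `b`, map to a function of bounded
level. -/
theorem translateFree_filter_mem_halfFree {n : ℕ} (hn : 1 ≤ n) {σ : Fin k → Boundary B → ℤ}
    (hσ : ∀ j, σ j ∈ levelFunctions B n) {y : (Fin k × FreeGroup B) →₀ ℤ}
    (hy : generatorMap σ y = 0) (b : B × Bool) :
    translateFree (FreeGroup.mk [b])
      (y.filter fun p => (b.1, !b.2) ∈ p.2.toWord.getLast?) ∈ halfFree σ n b := by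
  set y₁ := y.filter fun p => (b.1, !b.2) ∈ p.2.toWord.getLast? with hy₁
  set y₂ := y.filter fun p => ¬(b.1, !b.2) ∈ p.2.toWord.getLast? with hy₂
  have hsum : y₁ + y₂ = y := Finsupp.filter_add_filter_not _ _
  have h₁ : ∀ p ∈ (translateFree (FreeGroup.mk [b]) y₁).support,
      b ∉ p.2.toWord.getLast? := by
    intro p hp
    obtain ⟨q, hq, rfl⟩ := support_translateFree hp
    rw [hy₁, Finsupp.support_filter, Finset.mem_filter] at hq
    exact (toWord_mul_letter_of_cancel hq.2).2
  have h₂ : ∀ p ∈ (translateFree (FreeGroup.mk [b]) y₂).support,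
      p.2.toWord.getLast? = some b := by
    intro p hp
    obtain ⟨q, hq, rfl⟩ := support_translateFree hp
    rw [hy₂, Finsupp.support_filter, Finset.mem_filter] at hq
    exact getLast?_toWord_mul_letter_of_ne hq.2
  refine ⟨(Finsupp.mem_supported _ _).2 h₁, fun ξ η h => ?_⟩
  have hzero : generatorMap σ (translateFree (FreeGroup.mk [b]) y₁) +
      generatorMap σ (translateFree (FreeGroup.mk [b]) y₂) = 0 := by
    rw [← map_add, ← map_add, hsum, generatorMap_translateFree, hy, map_zero]
  by_cases hb : ξ.1 0 = (b.1, !b.2)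
  · refine generatorMap_eq_of_agree hn hσ h fun p hp x hx hξ => h₁ p hp ?_
    rw [hb] at hξ
    simp only [Prod.mk.injEq] at hξ
    obtain rfl : b = x := Prod.ext hξ.1 (by simpa using hξ.2)
    exact hx
  · have heq := generatorMap_eq_of_agree hn hσ h
      (x := translateFree (FreeGroup.mk [b]) y₂) fun p hp x hx hξ => hb ?_
    · have hξ := congrFun hzero ξ
      have hη := congrFun hzero η
      simp only [Pi.add_apply, Pi.zero_apply] at hξ hη
      linarith
    · rw [h₂ p hp] at hx
      obtain rfl : b = x := by simpa using hx
      exact hξ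

/-- Splitting an element of the free module according to the last letters of its terms. -/
theorem eq_filter_one_add_sum_filter [Fintype B] (y : (Fin k × FreeGroup B) →₀ ℤ) :
    y = y.filter (fun p => p.2 = 1) +
      ∑ b : B × Bool, y.filter fun p => (b.1, !b.2) ∈ p.2.toWord.getLast? := by
  ext p
  rw [Finsupp.add_apply, Finsupp.finsetSum_apply]
  by_cases hp : p.2 = 1
  · rw [Finsupp.filter_apply_pos (fun p : Fin k × FreeGroup B => p.2 = 1) _ hp, Finset.sum_eq_zero, add_zero]
    intro b _
    exact Finsupp.filter_apply_neg _ _ (by simp [hp])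
  · rw [Finsupp.filter_apply_neg (fun p : Fin k × FreeGroup B => p.2 = 1) _ hp, zero_add]
    have hne : p.2.toWord ≠ [] := fun h => hp (FreeGroup.toWord_eq_nil_iff.1 h)
    have hlast := List.getLast?_eq_some_getLast hne
    set x := p.2.toWord.getLast hne
    rw [Finset.sum_eq_single (x.1, !x.2)]
    · rw [Finsupp.filter_apply_pos]
      simp [hlast]
    · intro b _ hb
      refine Finsupp.filter_apply_neg _ _ fun h => hb ?_
      rw [hlast] at h
      obtain h : x = (b.1, !b.2) := by simpa using h
      simp [h]
    · simp

/-- The relations between functions of bounded level are generated, under translation, by those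
supported on a ball. -/
theorem exists_ball_generates_relations [Fintype B] {n : ℕ} (hn : 1 ≤ n)
    {σ : Fin k → Boundary B → ℤ} (hσ : ∀ j, σ j ∈ levelFunctions B n) :
    ∃ N, ∀ S : Submodule ℤ ((Fin k × FreeGroup B) →₀ ℤ),
      LinearMap.ker (generatorMap σ) ⊓ ballFree B k N ≤ S →
      (∀ b, ∀ x ∈ S, translateFree (FreeGroup.mk [b])⁻¹ x ∈ S) →
      LinearMap.ker (generatorMap σ) ≤ S := by
  refine (exists_filtration_step_generates (ballFree B k) ballFree_mono
    (fun b : B × Bool => translateFree (FreeGroup.mk [b])⁻¹) (LinearMap.ker (generatorMap σ))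
    (halfFree σ n) (generatorMap σ) ?_ ?_ ?_ ?_ ?_ ?_ ?_).imp fun _ hN => hN.2
  · intro b x hx
    rw [LinearMap.mem_ker] at hx ⊢
    rw [generatorMap_translateFree, hx, map_zero]
  · intro b m x hx
    rw [mem_ballFree] at hx ⊢
    intro p hp
    obtain ⟨q, hq, rfl⟩ := support_translateFree hp
    refine (FreeGroup.norm_mul_le _ _).trans (add_le_add (hx q hq) ?_)
    rw [FreeGroup.norm_inv_eq]
    exact FreeGroup.norm_mk_le
  · exact fun b => fg_of_le_levelFunctions (Submodule.map_le_iff_le_comap.2 inf_le_right)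
  · exact fun b x _ => exists_mem_ballFree x
  · exact fun x _ => exists_mem_ballFree x
  · exact fun b x _ h => h
  · intro m _ y hy hym
    rw [mem_ballFree] at hym
    refine ⟨y.filter fun p => p.2 = 1, ?_, fun b => translateFree (FreeGroup.mk [b])
      (y.filter fun p => (b.1, !b.2) ∈ p.2.toWord.getLast?),
      fun b => ⟨translateFree_filter_mem_halfFree hn hσ hy b, ?_⟩, ?_⟩
    · refine mem_ballFree.2 fun p hp => ?_
      rw [Finsupp.support_filter, Finset.mem_filter] at hp
      simp [hp.2]
    · refine mem_ballFree.2 fun p hp => ?_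
      obtain ⟨q, hq, rfl⟩ := support_translateFree hp
      rw [Finsupp.support_filter, Finset.mem_filter] at hq
      have := (toWord_mul_letter_of_cancel hq.2).1
      have := hym q hq.1
      simp only
      omega
    · simp only [translateFree_translateFree, mul_inv_cancel, translateFree_one]
      exact eq_filter_one_add_sum_filter y

end Relations

section DecompositionSpace

variable {B : Type} [DecidableEq B] {r : ℕ} {w : Fin r → FreeGroup B}

theorem actD_qmap (g : FreeGroup B) (ξ : Boundary B) :
    actD B w g (qmap B w ξ) = qmap B w (actB B g ξ) := by
  let A : DSpace B w → DSpace B w := Quot.map (actB B g) fun _ _ h => h.actB g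
  have hA : ∀ d, actD B w g d = A d := fun d => congrArg A (Quot.out_eq d)
  exact hA _

theorem pMap_qmap {k : ℕ} (σ : Fin k → DSpace B w → ℤ) (x : (Fin k × FreeGroup B) →₀ ℤ)
    (ξ : Boundary B) :
    pMap B w σ x (qmap B w ξ) = generatorMap (fun j => σ j ∘ qmap B w) x ξ := by
  simp only [pMap, generatorMap_apply, actD_qmap, Function.comp_apply]

theorem pMap_eq_iff {k : ℕ} (σ : Fin k → DSpace B w → ℤ) (x : (Fin k × FreeGroup B) →₀ ℤ)
    (τ : DSpace B w → ℤ) :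
    pMap B w σ x = τ ↔ generatorMap (fun j => σ j ∘ qmap B w) x = τ ∘ qmap B w := by
  constructor
  · rintro rfl
    funext ξ
    exact (pMap_qmap σ x ξ).symm
  · intro h
    funext d
    induction d using Quot.ind with
    | mk ξ => exact (pMap_qmap σ x ξ).trans (congrFun h ξ)

theorem continuous_iff_mem_invariantFunctions [Finite B] (τ : DSpace B w → ℤ) :
    Continuous τ ↔ τ ∘ qmap B w ∈ invariantFunctions w := by
  constructor
  · intro h
    exact ⟨exists_mem_levelFunctions_of_continuous (h.comp continuous_quot_mk),
      fun ξ η hl => congrArg τ (Quot.sound hl)⟩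
  · rintro ⟨⟨n, h⟩, -⟩
    exact continuous_coinduced_dom.2 (continuous_of_mem_levelFunctions h)

end DecompositionSpace

end DecompPaper

open DecompPaper
/-- the right `ℤ[F]`-module `C(D, ℤ)` (isomorphic to the zeroth Čech
cohomology of `D`) is finitely presented: there are finitely many continuous
generators `σ j`, and the kernel of the induced map `p : (ℤ[F])^k → C(D, ℤ)` is
finitely generated as a `ℤ[F]`-module. -/
theorem zeroth_cohomology_finitely_presented
    (B : Type) [Fintype B] [DecidableEq B] (hB : 2 ≤ Fintype.card B)
    (r : ℕ) (w : Fin r → FreeGroup B) (hw : ∀ i, w i ≠ 1) (hmal : Malnormal B w) :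
    ∃ (k : ℕ) (σ : Fin k → DSpace B w → ℤ),
      (∀ j, Continuous (σ j)) ∧
      (∀ τ : DSpace B w → ℤ, Continuous τ →
        ∃ x : (Fin k × FreeGroup B) →₀ ℤ, pMap B w σ x = τ) ∧
      ∃ (m : ℕ) (y : Fin m → (Fin k × FreeGroup B) →₀ ℤ),
        (∀ i, pMap B w σ (y i) = 0) ∧
        ∀ x : (Fin k × FreeGroup B) →₀ ℤ, pMap B w σ x = 0 →
          ∃ (l : ℕ) (c : Fin l → ℤ) (j : Fin l → Fin m) (g : Fin l → FreeGroup B),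
            x = ∑ i, c i • fsTranslate B (y (j i)) (g i) := by
  classical
  obtain ⟨N, hN, hgen⟩ := exists_level_generates_invariantFunctions w
  obtain ⟨k, s, hs⟩ := Submodule.fg_iff_exists_fin_generating_family.1
    (fg_of_le_levelFunctions (S := invariantFunctions w ⊓ levelFunctions B N) inf_le_right)
  have hmem : ∀ j, s j ∈ invariantFunctions w ⊓ levelFunctions B N :=
    fun j => hs ▸ Submodule.subset_span ⟨j, rfl⟩
  let σ : Fin k → DSpace B w → ℤ := fun j => Quot.lift (s j) (hmem j).1.2
  have hzero : ∀ x, pMap B w σ x = 0 ↔ generatorMap s x = 0 := fun x => pMap_eq_iff σ x 0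
  refine ⟨k, σ, fun j => (continuous_iff_mem_invariantFunctions _).2 (hmem j).1, ?_, ?_⟩
  · intro τ hτ
    have hle : invariantFunctions w ≤ LinearMap.range (generatorMap s) := by
      refine hgen _ ?_ ?_
      · rw [← hs, Submodule.span_le]
        rintro _ ⟨j, rfl⟩
        refine ⟨Finsupp.single (j, 1) 1, ?_⟩
        funext ξ
        simp [generatorMap_apply, actB_one]
      · rintro b _ ⟨x, rfl⟩
        exact ⟨_, generatorMap_translateFree s _ x⟩
    obtain ⟨x, hx⟩ := hle ((continuous_iff_mem_invariantFunctions τ).1 hτ)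
    exact ⟨x, (pMap_eq_iff σ x τ).2 hx⟩
  · obtain ⟨M, hM⟩ := exists_ball_generates_relations hN fun j => (hmem j).2
    obtain ⟨m, y, hy⟩ := Submodule.fg_iff_exists_fin_generating_family.1
      (fg_of_le_ballFree (S := LinearMap.ker (generatorMap s) ⊓ ballFree B k M) inf_le_right)
    refine ⟨m, y, fun i => ?_, fun x hx => ?_⟩
    · have : y i ∈ LinearMap.ker (generatorMap s) ⊓ ballFree B k M :=
        hy ▸ Submodule.subset_span ⟨i, rfl⟩
      exact (hzero _).2 this.1
    · let v : Fin m × FreeGroup B → ((Fin k × FreeGroup B) →₀ ℤ) :=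
        fun p => translateFree p.2 (y p.1)
      have hle : LinearMap.ker (generatorMap s) ≤ Submodule.span ℤ (Set.range v) := by
        refine hM _ ?_ ?_
        · rw [← hy, Submodule.span_le]
          rintro _ ⟨i, rfl⟩
          exact Submodule.subset_span ⟨(i, 1), translateFree_one _⟩
        · intro b z hz
          have hmap := Submodule.mem_map_of_mem (f := translateFree (FreeGroup.mk [b])⁻¹) hz
          rw [Submodule.map_span] at hmap
          refine Submodule.span_mono ?_ hmap
          rintro _ ⟨_, ⟨p, rfl⟩, rfl⟩
          exact ⟨(p.1, p.2 * (FreeGroup.mk [b])⁻¹), (translateFree_translateFree _ _ _).symm⟩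
      obtain ⟨c, hc⟩ := Finsupp.mem_span_range_iff_exists_finsupp.1 (hle ((hzero x).1 hx))
      let e := c.support.equivFin.symm
      refine ⟨c.support.card, fun i => c (e i), fun i => (e i).1.1, fun i => (e i).1.2, ?_⟩
      rw [← hc, Finsupp.sum, ← Finset.sum_coe_sort]
      exact (e.sum_comp fun p : c.support => c p • v p).symm
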